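/- (Null structure of the resonant quadratic source term) For every ω > 0 and ξ ∈ ℝ, the distorted Fourier transform F̃_{+,ω}[Q_{1,ω}](ξ) := ∫_ℝ ( Q_{1,ω}^{(1)}(x) conj(Ψ_{1,ω}(x,ξ)) - Q_{1,ω}^{(2)}(x) conj(Ψ_{2,ω}(x,ξ)) ) dx of the vector Q_{1,ω}(x) = ( -φ_ω(Φ₁² + 2Φ₁Φ₂), φ_ω(Φ₂² + 2Φ₁Φ₂) )ᵀ (with Φ₁(x)=(1/√(2π))tanh²(√ω x), Φ₂(x)=-(1/√(2π))sech²(√ω x)) equals (ω - ξ²) · (1/(24√π)) · ξ²(ω+ξ²)/(ω²(|ξ|+i√ω)²) · sech( (π/2)·ξ/√ω ). In particular it vanishes at ξ = ±√ω. -/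

import Mathlib

open MeasureTheory

noncomputable def phi (ω : ℝ) (x : ℝ) : ℝ :=
  Real.sqrt (2 * ω) * (1 / Real.cosh (Real.sqrt ω * x))

/-- Threshold resonance component Φ₁(x) = (1/√(2π))tanh²(√ω x). -/
noncomputable def Phi1 (ω : ℝ) (x : ℝ) : ℝ :=
  (1 / Real.sqrt (2 * Real.pi)) * (Real.tanh (Real.sqrt ω * x)) ^ 2

/-- Threshold resonance component Φ₂(x) = -(1/√(2π))sech²(√ω x). -/
noncomputable def Phi2 (ω : ℝ) (x : ℝ) : ℝ :=
  -(1 / Real.sqrt (2 * Real.pi)) * (1 / Real.cosh (Real.sqrt ω * x)) ^ 2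

/-- First component of the quadratic source term Q_{1,ω}. -/
noncomputable def Q11 (ω : ℝ) (x : ℝ) : ℝ :=
  -(phi ω x) * ((Phi1 ω x) ^ 2 + 2 * Phi1 ω x * Phi2 ω x)

/-- Second component of the quadratic source term Q_{1,ω}. -/
noncomputable def Q12 (ω : ℝ) (x : ℝ) : ℝ :=
  (phi ω x) * ((Phi2 ω x) ^ 2 + 2 * Phi1 ω x * Phi2 ω x)

/-- First component of the distorted Fourier basis. -/
noncomputable def Psi1 (ω : ℝ) (x ξ : ℝ) : ℂ :=
  ((1 / Real.sqrt (2 * Real.pi) : ℝ) : ℂ) *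
    (((ξ : ℂ) + Complex.I * (Real.sqrt ω : ℂ) * (Real.tanh (Real.sqrt ω * x) : ℂ)) ^ 2 /
      (((|ξ| : ℝ) : ℂ) - Complex.I * (Real.sqrt ω : ℂ)) ^ 2) *
    Complex.exp (Complex.I * (x : ℂ) * (ξ : ℂ))

/-- Second component of the distorted Fourier basis. -/
noncomputable def Psi2 (ω : ℝ) (x ξ : ℝ) : ℂ :=
  ((1 / Real.sqrt (2 * Real.pi) : ℝ) : ℂ) *
    (((ω * (1 / Real.cosh (Real.sqrt ω * x)) ^ 2 : ℝ) : ℂ) /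
      (((|ξ| : ℝ) : ℂ) - Complex.I * (Real.sqrt ω : ℂ)) ^ 2) *
    Complex.exp (Complex.I * (x : ℂ) * (ξ : ℂ))

/-- Distorted Fourier transform F̃_{+,ω}[Q_{1,ω}](ξ) = ⟨Q_{1,ω}, σ₃Ψ_{+,ω}(·,ξ)⟩. -/
noncomputable def dFTQ1 (ω : ℝ) (ξ : ℝ) : ℂ :=
  ∫ x : ℝ, ((Q11 ω x : ℂ) * (starRingEnd ℂ) (Psi1 ω x ξ)
    - (Q12 ω x : ℂ) * (starRingEnd ℂ) (Psi2 ω x ξ))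

/-- The basic oscillating integrand `tanh^n · sech · e^{-iky}`. -/
noncomputable def Wfun (k : ℝ) (n : ℕ) (y : ℝ) : ℂ :=
  (Real.tanh y : ℂ) ^ n * (((1 / Real.cosh y : ℝ) : ℂ) * Complex.exp (-(Complex.I * k * y)))

lemma hasDerivAt_tanh_aux (y : ℝ) : HasDerivAt Real.tanh (1 - Real.tanh y ^ 2) y := by
  have h := (Real.hasDerivAt_sinh y).div (Real.hasDerivAt_cosh y) (Real.cosh_pos y).ne'
  have e : Real.tanh = Real.sinh / Real.cosh := by
    ext z; simp [Real.tanh_eq_sinh_div_cosh]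
  rw [e]
  refine h.congr_deriv ?_
  have := (Real.cosh_pos y).ne'
  simp only [Pi.div_apply]
  field_simp

lemma hasDerivAt_sech_aux (y : ℝ) :
    HasDerivAt (fun y => 1 / Real.cosh y) (-(Real.tanh y * (1 / Real.cosh y))) y := by
  have h := (Real.hasDerivAt_cosh y).inv (Real.cosh_pos y).ne'
  have := (Real.cosh_pos y).ne'
  have e : (fun y => 1 / Real.cosh y) = Real.cosh⁻¹ := by ext z; simp
  rw [e]
  refine h.congr_deriv ?_
  · rw [Real.tanh_eq_sinh_div_cosh]; field_simp

lemma continuous_tanh_aux : Continuous Real.tanh :=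
  continuous_iff_continuousAt.2 fun y => (hasDerivAt_tanh_aux y).continuousAt

lemma continuous_sech_aux : Continuous (fun y => 1 / Real.cosh y) :=
  continuous_iff_continuousAt.2 fun y => (hasDerivAt_sech_aux y).continuousAt

lemma cosh_lower (y : ℝ) : (1 + y ^ 2) / 4 ≤ Real.cosh y := by
  have h := Real.quadratic_le_exp_of_nonneg (abs_nonneg y)
  rw [← Real.cosh_abs, Real.cosh_eq]
  have h2 := Real.exp_pos (-|y|)
  have h3 := abs_nonneg y
  have h4 := sq_abs y
  nlinarith

lemma integrable_sech_aux : Integrable (fun y => 1 / Real.cosh y) := by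
  refine (integrable_inv_one_add_sq.const_mul 4).mono' continuous_sech_aux.aestronglyMeasurable ?_
  refine Filter.Eventually.of_forall fun y => ?_
  have h := cosh_lower y
  have hp := Real.cosh_pos y
  rw [Real.norm_of_nonneg (by positivity), ← div_eq_mul_inv, div_le_div_iff₀ hp (by positivity)]
  linarith

lemma continuous_W (k : ℝ) (n : ℕ) : Continuous (Wfun k n) := by
  unfold Wfun
  have h1 := continuous_tanh_aux
  have h2 := continuous_sech_aux
  refine ((Complex.continuous_ofReal.comp h1).pow n).mul
    ((Complex.continuous_ofReal.comp h2).mul ?_)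
  fun_prop

lemma integrable_W (k : ℝ) (n : ℕ) : Integrable (Wfun k n) := by
  refine integrable_sech_aux.mono' (continuous_W k n).aestronglyMeasurable ?_
  refine Filter.Eventually.of_forall fun y => ?_
  have hp := Real.cosh_pos y
  have he : ‖Complex.exp (-(Complex.I * k * y))‖ = 1 := by
    rw [Complex.norm_exp]; simp
  unfold Wfun
  rw [norm_mul, norm_mul, he, norm_pow, Complex.norm_real, Complex.norm_real, mul_one,
    Real.norm_of_nonneg (show 0 ≤ 1 / Real.cosh y by positivity)]
  have : ‖Real.tanh y‖ ^ n ≤ 1 := pow_le_one₀ (norm_nonneg _) (Real.abs_tanh_lt_one y).le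
  have h0 : 0 ≤ 1 / Real.cosh y := by positivity
  nlinarith

lemma hasDerivAt_W (k : ℝ) (n : ℕ) (y : ℝ) :
    HasDerivAt (Wfun k n) ((n : ℂ) * Wfun k (n - 1) y - (n + 1) * Wfun k (n + 1) y
      - Complex.I * k * Wfun k n y) y := by
  have h1 := ((hasDerivAt_tanh_aux y).ofReal_comp).pow n
  have h2 := (hasDerivAt_sech_aux y).ofReal_comp
  have h3 : HasDerivAt (fun y : ℝ => Complex.exp (-(Complex.I * k * y)))
      (Complex.exp (-(Complex.I * k * y)) * (-(Complex.I * k))) y := by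
    have : HasDerivAt (fun y : ℝ => -(Complex.I * k * (y : ℂ))) (-(Complex.I * k)) y := by
      refine (((hasDerivAt_id y).ofReal_comp).const_mul (Complex.I * k)).neg.congr_deriv ?_
      simp
    exact this.cexp
  have h := h1.mul (h2.mul h3)
  refine h.congr_deriv ?_
  unfold Wfun
  rcases n with _ | n
  · simp; ring
  · simp [pow_succ]; ring

lemma W_rec (k : ℝ) (n : ℕ) :
    (n : ℂ) * (∫ y, Wfun k (n - 1) y) - (n + 1) * (∫ y, Wfun k (n + 1) y)
      - Complex.I * k * (∫ y, Wfun k n y) = 0 := by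
  have i1 := (integrable_W k (n - 1)).const_mul (n : ℂ)
  have i2 := (integrable_W k (n + 1)).const_mul ((n : ℂ) + 1)
  have i3 := (integrable_W k n).const_mul (Complex.I * k)
  have h := integral_eq_zero_of_hasDerivAt_of_integrable (hasDerivAt_W k n)
    ((i1.sub i2).sub i3) (integrable_W k n)
  have e1 := integral_sub (i1.sub i2) i3
  have e2 := integral_sub i1 i2
  simp only [Pi.sub_apply] at e1
  rw [e1, e2, integral_const_mul, integral_const_mul, integral_const_mul] at h
  exact h

/-- The Fourier transform of sech via the Beta function. -/
lemma W_zero (k : ℝ) :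
    ∫ y, Wfun k 0 y = (Real.pi : ℂ) * ((1 / Real.cosh (Real.pi / 2 * k) : ℝ) : ℂ) := by
  set u : ℂ := (1 - Complex.I * k) / 2 with hu
  have hre : u.re = 1 / 2 := by simp [hu]
  have hre' : (1 - u).re = 1 / 2 := by simp [hre]; norm_num
  have hB : Complex.betaIntegral u (1 - u) = Real.pi / Complex.sin (Real.pi * u) := by
    have h := Complex.Gamma_mul_Gamma_eq_betaIntegral (s := u) (t := 1 - u)
      (by rw [hre]; norm_num) (by rw [hre']; norm_num)
    rw [Complex.Gamma_mul_Gamma_one_sub] at h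
    simpa using h.symm
  have hsin : Complex.sin (Real.pi * u) = ((Real.cosh (Real.pi / 2 * k) : ℝ) : ℂ) := by
    have : (Real.pi : ℂ) * u = Real.pi / 2 - (Real.pi / 2 * k : ℂ) * Complex.I := by
      rw [hu]; ring
    rw [this, Complex.sin_pi_div_two_sub, Complex.cos_mul_I]
    push_cast; rfl
  -- change of variables
  let f : ℝ → ℝ := fun y => (1 + Real.tanh y) / 2
  have hf' : ∀ y ∈ (Set.univ : Set ℝ),
      HasDerivWithinAt f ((1 - Real.tanh y ^ 2) / 2) Set.univ y := fun y _ =>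
    (((hasDerivAt_tanh_aux y).const_add 1).div_const 2).hasDerivWithinAt
  have hinj : Set.InjOn f Set.univ := by
    intro a _ b _ hab
    have : Real.tanh a = Real.tanh b := by simp only [f] at hab; linarith
    exact Real.tanh_injective this
  have himg : f '' Set.univ = Set.Ioo 0 1 := by
    ext z
    constructor
    · rintro ⟨y, -, rfl⟩
      have h1 := Real.neg_one_lt_tanh y
      have h2 := Real.tanh_lt_one y
      constructor <;> simp only [f] <;> linarith
    · rintro ⟨h1, h2⟩
      refine ⟨Real.artanh (2 * z - 1), trivial, ?_⟩
      simp only [f]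
      rw [Real.tanh_artanh (by constructor <;> linarith)]
      ring
  have hcv := integral_image_eq_integral_abs_deriv_smul MeasurableSet.univ hf' hinj
    (fun x : ℝ => (x : ℂ) ^ (u - 1) * (1 - (x : ℂ)) ^ ((1 - u) - 1))
  rw [himg, ← integral_Ioc_eq_integral_Ioo, ← intervalIntegral.integral_of_le zero_le_one,
    setIntegral_univ] at hcv
  change Complex.betaIntegral u (1 - u) = _ at hcv
  rw [hB, hsin] at hcv
  have hfin : ∀ y : ℝ, |(1 - Real.tanh y ^ 2) / 2| •
      (((f y : ℝ) : ℂ) ^ (u - 1) * (1 - ((f y : ℝ) : ℂ)) ^ ((1 - u) - 1)) = Wfun k 0 y := by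
    intro y
    have hc := Real.cosh_pos y
    have e1 : f y = Real.exp (y - Real.log (2 * Real.cosh y)) := by
      rw [Real.exp_sub, Real.exp_log (by positivity)]
      simp only [f]
      rw [Real.tanh_eq_sinh_div_cosh, ← Real.cosh_add_sinh]
      field_simp
    have e2 : 1 - f y = Real.exp (-y - Real.log (2 * Real.cosh y)) := by
      rw [Real.exp_sub, Real.exp_log (by positivity)]
      simp only [f]
      rw [Real.tanh_eq_sinh_div_cosh, ← Real.cosh_sub_sinh]
      field_simp
      ring
    have e3 : |(1 - Real.tanh y ^ 2) / 2| = 2 * (f y * (1 - f y)) := by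
      have := Real.tanh_sq_lt_one y
      rw [abs_of_pos (by linarith)]
      simp only [f]; ring
    have e4 : (1 / Real.cosh y) = 2 * Real.exp (-Real.log (2 * Real.cosh y)) := by
      rw [Real.exp_neg, Real.exp_log (by positivity)]; field_simp
    have e2' : (1 - ((f y : ℝ) : ℂ)) = ((1 - f y : ℝ) : ℂ) := by push_cast; rfl
    unfold Wfun
    rw [e2', e3, e2, e1, e4]
    generalize Real.log (2 * Real.cosh y) = L
    rw [Complex.cpow_def_of_ne_zero (by exact_mod_cast (Real.exp_pos _).ne'),
      Complex.cpow_def_of_ne_zero (by exact_mod_cast (Real.exp_pos _).ne'),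
      ← Complex.ofReal_log (Real.exp_pos _).le, ← Complex.ofReal_log (Real.exp_pos _).le,
      Real.log_exp, Real.log_exp, Complex.real_smul]
    push_cast
    rw [pow_zero, one_mul, mul_assoc, mul_assoc, mul_assoc, ← Complex.exp_add,
      ← Complex.exp_add, ← Complex.exp_add, ← Complex.exp_add]
    congr 2
    rw [hu]; ring
  rw [integral_congr_ae (Filter.Eventually.of_forall hfin)] at hcv
  rw [← hcv]
  push_cast
  ring

/-- The combination of basic integrands that occurs in the transform. -/
noncomputable def Gfun (k : ℝ) (y : ℝ) : ℂ :=
  (6 * Wfun k 6 y + 6 * (Complex.I * k) * Wfun k 5 y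
        + (3 * (Complex.I * k) ^ 2 - 9) * Wfun k 4 y - 4 * (Complex.I * k) * Wfun k 3 y
        + (5 - 2 * (Complex.I * k) ^ 2) * Wfun k 2 y - Wfun k 0 y)

lemma W_poly (k : ℝ) :
    ∫ y, Gfun k y
      = (k : ℂ) ^ 2 * (1 - (k : ℂ) ^ 2) * (1 + (k : ℂ) ^ 2) / 12 *
        ((Real.pi : ℂ) * ((1 / Real.cosh (Real.pi / 2 * k) : ℝ) : ℂ)) := by
  have i6 := (integrable_W k 6).const_mul (6 : ℂ)
  have i5 := (integrable_W k 5).const_mul (6 * (Complex.I * k))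
  have i4 := (integrable_W k 4).const_mul (3 * (Complex.I * k) ^ 2 - 9)
  have i3 := (integrable_W k 3).const_mul (4 * (Complex.I * k))
  have i2 := (integrable_W k 2).const_mul (5 - 2 * (Complex.I * k) ^ 2)
  have i0 := integrable_W k 0
  have e1 := integral_sub ((((i6.add i5).add i4).sub i3).add i2) i0
  have e2 := integral_add (((i6.add i5).add i4).sub i3) i2
  have e3 := integral_sub ((i6.add i5).add i4) i3
  have e4 := integral_add (i6.add i5) i4
  simp only [Pi.sub_apply, Pi.add_apply] at e1 e2 e3 e4
  unfold Gfun
  rw [e1, e2, e3, e4, integral_add i6 i5]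
  simp only [integral_const_mul]
  rw [← W_zero]
  have r0 := W_rec k 0
  have r1 := W_rec k 1
  have r2 := W_rec k 2
  have r3 := W_rec k 3
  have r4 := W_rec k 4
  have r5 := W_rec k 5
  norm_num at r0 r1 r2 r3 r4 r5
  have hq : (k : ℂ) ^ 2 = -(Complex.I * k) ^ 2 := by rw [mul_pow, Complex.I_sq]; ring
  rw [hq]
  generalize Complex.I * (k : ℂ) = q at *
  linear_combination (-1 : ℂ) * r5 - q * r4 + (1 - q ^ 2 / 2) * r3 + (-q / 3 + q ^ 3 / 6) * r2
    + (-1 + 5 * q ^ 2 / 12 - q ^ 4 / 12) * r1 + (q / 3 - q ^ 3 / 12 + q ^ 5 / 12) * r0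

lemma integrand_eq (ω : ℝ) (hω : 0 < ω) (ξ x : ℝ) :
    ((Q11 ω x : ℂ) * (starRingEnd ℂ) (Psi1 ω x ξ)
      - (Q12 ω x : ℂ) * (starRingEnd ℂ) (Psi2 ω x ξ)) =
    ((Real.sqrt 2 * Real.sqrt ω * ω / Real.sqrt (2 * Real.pi) ^ 3 : ℝ) : ℂ)
      / (((|ξ| : ℝ) : ℂ) + Complex.I * (Real.sqrt ω : ℂ)) ^ 2 *
    Gfun (ξ / Real.sqrt ω) (Real.sqrt ω * x) := by
  obtain ⟨s, hs, rfl⟩ : ∃ s : ℝ, 0 < s ∧ ω = s ^ 2 :=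
    ⟨Real.sqrt ω, Real.sqrt_pos.2 hω, (Real.sq_sqrt hω.le).symm⟩
  obtain ⟨k, rfl⟩ : ∃ k : ℝ, ξ = s * k := ⟨ξ / s, by field_simp⟩
  have hk : s * k / s = k := by field_simp
  have hD : (((|s * k| : ℝ) : ℂ) + Complex.I * (s : ℂ)) ≠ 0 := by
    intro h
    have := congrArg Complex.im h
    simp at this
    exact hs.ne' this
  simp only [Gfun, Wfun, Q11, Q12, Psi1, Psi2, phi, Phi1, Phi2, Real.sqrt_sq hs.le, hk,
    Real.sqrt_mul zero_le_two (s ^ 2)]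
  have hp : Real.sqrt (2 * Real.pi) ≠ 0 := by positivity
  have hsech : (1 / Real.cosh (s * x)) ^ 2 = 1 - Real.tanh (s * x) ^ 2 := by
    have := (Real.cosh_pos (s * x)).ne'
    have h2 := Real.cosh_sq (s * x)
    rw [Real.tanh_eq_sinh_div_cosh]; field_simp; linarith
  rw [hsech]
  generalize 1 / Real.cosh (s * x) = c at *
  generalize Real.tanh (s * x) = t at *
  generalize Real.sqrt (2 * Real.pi) = p at *
  have hexp : (starRingEnd ℂ) (Complex.exp (Complex.I * (x : ℂ) * ((s * k : ℝ) : ℂ)))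
      = Complex.exp (-(Complex.I * k * ((s * x : ℝ) : ℂ))) := by
    rw [← Complex.exp_conj]
    congr 1
    simp
    ring
  simp only [map_mul, map_div₀, map_pow, map_sub, map_add, Complex.conj_ofReal, Complex.conj_I,
    hexp]
  generalize Complex.exp (-(Complex.I * k * ((s * x : ℝ) : ℂ))) = E
  have hD2 : (((|s * k| : ℝ) : ℂ) - -Complex.I * (s : ℂ)) = ((|s * k| : ℝ) : ℂ) + Complex.I * (s : ℂ) := by ring
  rw [hD2]
  generalize ((|s * k| : ℝ) : ℂ) + Complex.I * (s : ℂ) = D at *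
  have hp' : (p : ℂ) ≠ 0 := by exact_mod_cast hp
  have hII : ((s * k : ℝ) : ℂ) + -Complex.I * s * t = -Complex.I * s * (Complex.I * k + t) := by
    push_cast
    linear_combination ((s : ℂ) * k) * Complex.I_sq
  have hII2 : (-Complex.I * (s : ℂ) * (Complex.I * k + t)) ^ 2
      = -((s : ℂ) ^ 2 * (Complex.I * k + t) ^ 2) := by
    linear_combination ((s : ℂ) ^ 2 * (Complex.I * k + t) ^ 2) * Complex.I_sq
  rw [hII, hII2]
  push_cast
  generalize Complex.I * (k : ℂ) = q
  field_simp
  ring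

/-- Null structure of the resonant quadratic source term: explicit formula for
F̃_{+,ω}[Q_{1,ω}](ξ), which vanishes at the resonant frequencies ξ = ±√ω. -/
theorem null_structure_quadratic_source (ω : ℝ) (hω : 0 < ω) :
    (∀ ξ : ℝ,
      dFTQ1 ω ξ
        = ((ω - ξ ^ 2 : ℝ) : ℂ) * ((1 / (24 * Real.sqrt Real.pi) : ℝ) : ℂ) *
          (((ξ ^ 2 * (ω + ξ ^ 2) : ℝ) : ℂ) /
            (((ω ^ 2 : ℝ) : ℂ) * (((|ξ| : ℝ) : ℂ) + Complex.I * (Real.sqrt ω : ℂ)) ^ 2)) *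
          ((1 / Real.cosh ((Real.pi / 2) * ξ / Real.sqrt ω) : ℝ) : ℂ)) ∧
    dFTQ1 ω (Real.sqrt ω) = 0 ∧ dFTQ1 ω (-(Real.sqrt ω)) = 0 := by
  have key : ∀ ξ : ℝ,
      dFTQ1 ω ξ
        = ((ω - ξ ^ 2 : ℝ) : ℂ) * ((1 / (24 * Real.sqrt Real.pi) : ℝ) : ℂ) *
          (((ξ ^ 2 * (ω + ξ ^ 2) : ℝ) : ℂ) /
            (((ω ^ 2 : ℝ) : ℂ) * (((|ξ| : ℝ) : ℂ) + Complex.I * (Real.sqrt ω : ℂ)) ^ 2)) *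
          ((1 / Real.cosh ((Real.pi / 2) * ξ / Real.sqrt ω) : ℝ) : ℂ) := by
    intro ξ
    unfold dFTQ1
    rw [integral_congr_ae (Filter.Eventually.of_forall (integrand_eq ω hω ξ)),
      integral_const_mul, Measure.integral_comp_mul_left (Gfun (ξ / Real.sqrt ω)), W_poly]
    obtain ⟨s, hs, rfl⟩ : ∃ s : ℝ, 0 < s ∧ ω = s ^ 2 :=
      ⟨Real.sqrt ω, Real.sqrt_pos.2 hω, (Real.sq_sqrt hω.le).symm⟩
    obtain ⟨k, rfl⟩ : ∃ k : ℝ, ξ = s * k := ⟨ξ / s, by field_simp⟩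
    have hk : s * k / s = k := by field_simp
    have hk2 : Real.pi / 2 * (s * k) / s = Real.pi / 2 * k := by field_simp
    have hD : (((|s * k| : ℝ) : ℂ) + Complex.I * (s : ℂ)) ≠ 0 := by
      intro h
      have := congrArg Complex.im h
      simp at this
      exact hs.ne' this
    rw [Real.sqrt_sq hs.le, hk, hk2]
    generalize 1 / Real.cosh (Real.pi / 2 * k) = c
    generalize ((|s * k| : ℝ) : ℂ) + Complex.I * (s : ℂ) = D at *
    rw [abs_of_pos (by positivity), Complex.real_smul, Real.sqrt_mul zero_le_two]
    have h2 : Real.sqrt 2 ^ 2 = 2 := Real.sq_sqrt (by norm_num)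
    have hpi : Real.pi = Real.sqrt Real.pi ^ 2 := (Real.sq_sqrt Real.pi_pos.le).symm
    have hpp : 0 < Real.sqrt Real.pi := Real.sqrt_pos.2 Real.pi_pos
    have h2p : 0 < Real.sqrt 2 := by positivity
    have hconst : Real.sqrt 2 * s * s ^ 2 / (Real.sqrt 2 * Real.sqrt Real.pi) ^ 3
        = s ^ 3 / (2 * Real.sqrt Real.pi ^ 3) := by
      field_simp
      linarith
    have hpiC : (Real.pi : ℂ) = (Real.sqrt Real.pi : ℂ) ^ 2 := by exact_mod_cast hpi
    rw [hconst, hpiC]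
    generalize Real.sqrt Real.pi = p at *
    have hp' : (p : ℂ) ≠ 0 := by exact_mod_cast hpp.ne'
    have hs' : (s : ℂ) ≠ 0 := by exact_mod_cast hs.ne'
    push_cast
    field_simp
    ring
  refine ⟨key, ?_, ?_⟩
  · rw [key, Real.sq_sqrt hω.le]; simp
  · rw [key, neg_sq, Real.sq_sqrt hω.le]; simp
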